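/- Let B be the symmetric bilinear form on ℝ² with B(e₁,e₁)=108, B(e₁,e₂)=B(e₂,e₁)=45, B(e₂,e₂)=27, and for λ ∈ ℝ let C_λ = {a·(0,1) + b·(1,−λ) : a,b ≥ 0} ⊆ ℝ². Then for every λ with 1 ≤ λ ≤ 8/5, the dual cone {w ∈ ℝ² : B(w,v) ≥ 0 for all v ∈ C_λ} equals the cone {a·(3,−5) + b·(27λ−45, 108−45λ) : a,b ≥ 0}. -/

import Mathlib

/-- The cone `C_λ = {a·(0,1) + b·(1,−λ) : a, b ≥ 0} ⊆ ℝ²`. -/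
def coneLam (lam : ℝ) : Set (Fin 2 → ℝ) :=
  {p | ∃ a b : ℝ, 0 ≤ a ∧ 0 ≤ b ∧ p = a • ![0, 1] + b • ![1, -lam]}

/-- A bilinear form on `ℝ²` in terms of its values on the standard basis. -/
theorem bilinForm_fin_two_apply (B : LinearMap.BilinForm ℝ (Fin 2 → ℝ)) (u v : Fin 2 → ℝ) :
    B u v = u 0 * v 0 * B ![1, 0] ![1, 0] + u 0 * v 1 * B ![1, 0] ![0, 1] +
      u 1 * v 0 * B ![0, 1] ![1, 0] + u 1 * v 1 * B ![0, 1] ![0, 1] := by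
  have key (w : Fin 2 → ℝ) : w = w 0 • ![1, 0] + w 1 • ![0, 1] := by
    ext i; fin_cases i <;> simp
  conv_lhs => rw [key u, key v]
  simp only [map_add, map_smul, LinearMap.add_apply, LinearMap.smul_apply, smul_eq_mul]
  ring

/-- For `B` the symmetric bilinear form on ℝ² with `B(e₁,e₁)=108`, `B(e₁,e₂)=B(e₂,e₁)=45`,
`B(e₂,e₂)=27`, and every `λ` with `1 ≤ λ ≤ 8/5`, the dual cone of `C_λ` with respect to `B`
equals the cone `{a·(3,−5) + b·(27λ−45, 108−45λ) : a, b ≥ 0}`. -/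
theorem stmt_5 (B : LinearMap.BilinForm ℝ (Fin 2 → ℝ))
    (hsymm : ∀ u v : Fin 2 → ℝ, B u v = B v u)
    (h11 : B ![1, 0] ![1, 0] = 108) (h12 : B ![1, 0] ![0, 1] = 45)
    (h21 : B ![0, 1] ![1, 0] = 45) (h22 : B ![0, 1] ![0, 1] = 27)
    (lam : ℝ) (hlam1 : 1 ≤ lam) (hlam2 : lam ≤ 8 / 5) :
    {w : Fin 2 → ℝ | ∀ v ∈ coneLam lam, 0 ≤ B w v} =
      {w : Fin 2 → ℝ | ∃ a b : ℝ, 0 ≤ a ∧ 0 ≤ b ∧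
        w = a • ![3, -5] + b • ![27 * lam - 45, 108 - 45 * lam]} := by
  have hB (u v : Fin 2 → ℝ) : B u v =
      108 * (u 0 * v 0) + 45 * (u 0 * v 1 + u 1 * v 0) + 27 * (u 1 * v 1) := by
    rw [bilinForm_fin_two_apply, h11, h12, h21, h22]
    ring
  ext w
  constructor
  · intro hw
    have hP := hw ![0, 1] ⟨1, 0, by simp, by simp, by simp⟩
    have hQ := hw ![1, -lam] ⟨0, 1, by simp, by simp, by simp⟩
    refine ⟨B w ![1, -lam] / 99, B w ![0, 1] / 891, by positivity, by positivity, ?_⟩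
    ext i
    fin_cases i <;> simp [hB] <;> ring
  · rintro ⟨a, b, ha, hb, rfl⟩ v ⟨c, d, hc, hd, rfl⟩
    have h : 0 ≤ 99 * (a * d) + 891 * (b * c) := by positivity
    convert h using 1
    simp [hB]
    ring
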